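/- arXiv:2012.06947 — 3 statements merged into one kernel-verified Lean document; each statement's English description precedes it below -/
import Mathlib

section
/- Let W be a real m×n matrix, D a real T×n matrix, B₁ a real n×T matrix, and B₂ a real n×r matrix. Assume: (i) every p ∈ ℝ^n can be written as p = B₁x + B₂y for some x ∈ ℝ^T and y ∈ ℝ^r; (ii) D·B₂ = 0; and (iii) the T×T matrix D̃ := D·B₁ is invertible. Then for every z ∈ ℝ^m, b ∈ ℝ^T, and p₀ ∈ ℝ^T, the following are equivalent: (a) there exists p ∈ ℝ^n with W·p ≤ z entrywise and D·p + b = p₀; (b) there exists y ∈ ℝ^r with W·B₁·D̃⁻¹·(p₀ − b) + W·B₂·y ≤ z entrywise. -/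
open Matrix

/-- Equivalence between the original disaggregation feasibility constraints
(∃ p with W·p ≤ z and D·p + b = p₀) and the reduced constraints after eliminating the
equality via the coordinate change p = B₁x + B₂y, where D·B₂ = 0 and D̃ = D·B₁ is invertible. -/
theorem feasibility_reformulation
    (m n T r : ℕ)
    (W : Matrix (Fin m) (Fin n) ℝ)
    (D : Matrix (Fin T) (Fin n) ℝ)
    (B₁ : Matrix (Fin n) (Fin T) ℝ)
    (B₂ : Matrix (Fin n) (Fin r) ℝ)
    (hspan : ∀ p : Fin n → ℝ, ∃ (x : Fin T → ℝ) (y : Fin r → ℝ),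
      p = B₁.mulVec x + B₂.mulVec y)
    (hDB₂ : D * B₂ = 0)
    (hinv : IsUnit (D * B₁)) :
    ∀ (z : Fin m → ℝ) (b : Fin T → ℝ) (p₀ : Fin T → ℝ),
      (∃ p : Fin n → ℝ, W.mulVec p ≤ z ∧ D.mulVec p + b = p₀) ↔
      (∃ y : Fin r → ℝ,
        (W * B₁ * (D * B₁)⁻¹).mulVec (p₀ - b) + (W * B₂).mulVec y ≤ z) := by
  intro z b p₀
  have hdet : IsUnit (D * B₁).det := (isUnit_iff_isUnit_det _).mp hinv
  constructor
  · rintro ⟨p, hW, hD⟩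
    obtain ⟨x, y, rfl⟩ := hspan p
    have hx : p₀ - b = (D * B₁).mulVec x := by
      rw [← hD, mulVec_add, mulVec_mulVec, mulVec_mulVec, hDB₂, zero_mulVec, add_zero,
        add_sub_cancel_right]
    refine ⟨y, ?_⟩
    rwa [hx, mulVec_mulVec, Matrix.mul_assoc (W * B₁), nonsing_inv_mul _ hdet, Matrix.mul_one,
      ← mulVec_mulVec, ← mulVec_mulVec, ← mulVec_add]
  · rintro ⟨y, hy⟩
    refine ⟨B₁.mulVec ((D * B₁)⁻¹.mulVec (p₀ - b)) + B₂.mulVec y, ?_, ?_⟩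
    · rwa [mulVec_add, mulVec_mulVec, mulVec_mulVec, mulVec_mulVec]
    · rw [mulVec_add, mulVec_mulVec, mulVec_mulVec, mulVec_mulVec, mul_nonsing_inv _ hdet,
        one_mulVec, hDB₂, zero_mulVec, add_zero, sub_add_cancel]
end

section
/- Let T, N_u, q be positive integers. Let w₁ ∈ ℝ^T, w₂ ∈ ℝ^q, ν ∈ ℝ, θ₁, …, θ_T ∈ ℝ^{N_u}, let E and A be real T×T matrices, e ∈ ℝ^T, K a real q×T matrix, L₁, …, L_T real q×N_u matrices, and γ ∈ ℝ^q. Then the following are equivalent: (a) for every ξ ∈ ℝ^T with ‖ξ‖ ≤ 1 and every ζ₁, …, ζ_T ∈ ℝ^{N_u} with ‖ζ_t‖ ≤ 1 for all t, one has w₁ᵀ·A·(E·ξ + e) + w₂ᵀ·(K·ξ + Σ_{t=1}^T L_t·ζ_t + γ) ≤ Σ_{t=1}^T θ_tᵀ·ζ_t + ν; (b) ‖Eᵀ·Aᵀ·w₁ + Kᵀ·w₂‖ + Σ_{t=1}^T ‖L_tᵀ·w₂ − θ_t‖ + w₁ᵀ·A·e + w₂ᵀ·γ − ν ≤ 0.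 -/
open Matrix

/-- The Euclidean norm of a vector in ℝ^n. -/
noncomputable def euclNorm {n : ℕ} (v : Fin n → ℝ) : ℝ := Real.sqrt (∑ i, v i ^ 2)

theorem dotProduct_le_euclNorm {n : ℕ} (a x : Fin n → ℝ) (hx : euclNorm x ≤ 1) :
    a ⬝ᵥ x ≤ euclNorm a :=
  (Real.sum_mul_le_sqrt_mul_sqrt Finset.univ a x).trans
    (mul_le_of_le_one_right (Real.sqrt_nonneg _) hx)

theorem exists_dotProduct_eq_euclNorm {n : ℕ} (a : Fin n → ℝ) :
    ∃ x : Fin n → ℝ, euclNorm x ≤ 1 ∧ a ⬝ᵥ x = euclNorm a := by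
  have hsq : a ⬝ᵥ a = euclNorm a ^ 2 := by
    rw [euclNorm, Real.sq_sqrt (Finset.sum_nonneg fun i _ => sq_nonneg (a i))]
    simp only [dotProduct, sq]
  refine ⟨(euclNorm a)⁻¹ • a, ?_, ?_⟩
  · rw [euclNorm, Real.sqrt_le_one]
    simp only [Pi.smul_apply, smul_eq_mul, mul_pow, ← Finset.mul_sum]
    simp only [dotProduct, ← sq] at hsq
    rw [hsq, ← mul_pow]
    exact pow_le_one₀ (mul_nonneg (inv_nonneg.2 (Real.sqrt_nonneg _)) (Real.sqrt_nonneg _))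
      inv_mul_le_one
  · rw [dotProduct_smul, hsq, smul_eq_mul, sq, ← mul_assoc]
    exact inv_mul_mul_self (euclNorm a)

theorem affine_policy_constraint_decomposition {T Nu q : ℕ}
    (w₁ : Fin T → ℝ) (w₂ : Fin q → ℝ) (θ : Fin T → Fin Nu → ℝ)
    (E A : Matrix (Fin T) (Fin T) ℝ) (e : Fin T → ℝ)
    (K : Matrix (Fin q) (Fin T) ℝ) (L : Fin T → Matrix (Fin q) (Fin Nu) ℝ)
    (γ : Fin q → ℝ) (ξ : Fin T → ℝ) (ζ : Fin T → Fin Nu → ℝ) :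
    w₁ ⬝ᵥ A.mulVec (E.mulVec ξ + e) +
        w₂ ⬝ᵥ (K.mulVec ξ + (∑ t, (L t).mulVec (ζ t)) + γ) =
      ((Eᵀ * Aᵀ).mulVec w₁ + Kᵀ.mulVec w₂) ⬝ᵥ ξ +
        (∑ t, ((L t)ᵀ.mulVec w₂ - θ t) ⬝ᵥ ζ t) + (∑ t, θ t ⬝ᵥ ζ t) +
        w₁ ⬝ᵥ A.mulVec e + w₂ ⬝ᵥ γ := by
  simp only [← transpose_mul, mulVec_transpose, add_dotProduct, sub_dotProduct,
    ← dotProduct_mulVec, mulVec_add, dotProduct_add, mulVec_mulVec, dotProduct_sum,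
    Finset.sum_sub_distrib]
  ring

/-- Exact tractable reformulation of one robust constraint of the affine-policy
problem: the robust inequality
w₁ᵀA(Eξ + e) + w₂ᵀ(Kξ + Σ_t L_t ζ_t + γ) ≤ Σ_t θ_tᵀζ_t + ν for all ‖ξ‖ ≤ 1, ‖ζ_t‖ ≤ 1
holds iff ‖EᵀAᵀw₁ + Kᵀw₂‖ + Σ_t ‖L_tᵀw₂ − θ_t‖ + w₁ᵀAe + w₂ᵀγ − ν ≤ 0. -/
theorem affine_policy_constraint_reformulation
    (T Nu q : ℕ) (hT : 0 < T) (hNu : 0 < Nu) (hq : 0 < q)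
    (w₁ : Fin T → ℝ) (w₂ : Fin q → ℝ) (ν : ℝ) (θ : Fin T → Fin Nu → ℝ)
    (E A : Matrix (Fin T) (Fin T) ℝ) (e : Fin T → ℝ)
    (K : Matrix (Fin q) (Fin T) ℝ) (L : Fin T → Matrix (Fin q) (Fin Nu) ℝ)
    (γ : Fin q → ℝ) :
    (∀ (ξ : Fin T → ℝ) (ζ : Fin T → Fin Nu → ℝ),
        euclNorm ξ ≤ 1 → (∀ t, euclNorm (ζ t) ≤ 1) →
        w₁ ⬝ᵥ A.mulVec (E.mulVec ξ + e) +
          w₂ ⬝ᵥ (K.mulVec ξ + (∑ t, (L t).mulVec (ζ t)) + γ) ≤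
        (∑ t, θ t ⬝ᵥ ζ t) + ν) ↔
      euclNorm ((Eᵀ * Aᵀ).mulVec w₁ + Kᵀ.mulVec w₂) +
        (∑ t, euclNorm ((L t)ᵀ.mulVec w₂ - θ t)) +
        w₁ ⬝ᵥ A.mulVec e + w₂ ⬝ᵥ γ - ν ≤ 0 := by
  simp only [affine_policy_constraint_decomposition w₁ w₂ θ E A e K L γ]
  constructor
  · intro h
    obtain ⟨ξ, hξ, hξ_eq⟩ :=
      exists_dotProduct_eq_euclNorm ((Eᵀ * Aᵀ).mulVec w₁ + Kᵀ.mulVec w₂)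
    choose ζ hζ hζ_eq using
      fun t => exists_dotProduct_eq_euclNorm ((L t)ᵀ.mulVec w₂ - θ t)
    have key := h ξ ζ hξ hζ
    simp only [hξ_eq, hζ_eq] at key
    linarith
  · intro h ξ ζ hξ hζ
    have hξ_le := dotProduct_le_euclNorm ((Eᵀ * Aᵀ).mulVec w₁ + Kᵀ.mulVec w₂) ξ hξ
    have hζ_le := Finset.sum_le_sum fun t (_ : t ∈ Finset.univ) =>
      dotProduct_le_euclNorm ((L t)ᵀ.mulVec w₂ - θ t) (ζ t) (hζ t)
    linarith
end

section
/- Let T and N_u be positive integers, let a ∈ ℝ^T, let b₁, …, b_T ∈ ℝ^{N_u}, let s ∈ ℝ, and let λ₀, λ₁, …, λ_{T+1} be nonnegative real numbers. Let ρ ∈ ℝ^{T + T·N_u} be one half of the concatenation of (a, b₁, …, b_T). If the symmetric (1 + T + T·N_u)×(1 + T + T·N_u) matrix diag(λ₀, λ₁·I_T, λ₂·I_{N_u}, …, λ_{T+1}·I_{N_u}) − [[0, ρᵀ],[ρ, 0]] is positive semidefinite and λ₀ + λ₁ + ⋯ + λ_{T+1} + s ≤ 0, then ‖a‖ + Σ_{t=1}^T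 ‖b_t‖ + s ≤ 0. -/
open Matrix

theorem exists_sum_sq_le_one_sum_mul_eq_euclNorm {n : ℕ} (v : Fin n → ℝ) :
    ∃ w : Fin n → ℝ, ∑ i, w i ^ 2 ≤ 1 ∧ ∑ i, v i * w i = euclNorm v := by
  have hsq : euclNorm v ^ 2 = ∑ i, v i ^ 2 :=
    Real.sq_sqrt (Finset.sum_nonneg fun i _ => sq_nonneg (v i))
  refine ⟨fun i => (euclNorm v)⁻¹ * v i, ?_, ?_⟩
  · simp only [mul_pow, ← Finset.mul_sum, ← hsq]
    rw [← mul_pow]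
    rcases eq_or_ne (euclNorm v) 0 with h | h <;> simp [h]
  · have : ∀ i, v i * ((euclNorm v)⁻¹ * v i) = (euclNorm v)⁻¹ * v i ^ 2 := fun i => by ring
    simp only [this, ← Finset.mul_sum, ← hsq]
    rcases eq_or_ne (euclNorm v) 0 with h | h
    · simp [h]
    · field_simp

/-- Let ρ be half the concatenation of (a, b₁, …, b_T). If λ₀, …, λ_{T+1} ≥ 0,
the matrix diag(λ₀, λ₁·I_T, λ₂·I_{N_u}, …, λ_{T+1}·I_{N_u}) − [[0, ρᵀ],[ρ, 0]] is positive
semidefinite, and λ₀ + ⋯ + λ_{T+1} + s ≤ 0, then ‖a‖ + Σ_t ‖b_t‖ + s ≤ 0. -/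
theorem certificate_implies_norm_bound
    (T Nu : ℕ) (hT : 0 < T) (hNu : 0 < Nu)
    (a : Fin T → ℝ) (b : Fin T → Fin Nu → ℝ) (s : ℝ)
    (lam : Fin (T + 2) → ℝ) (hlam : ∀ k, 0 ≤ lam k)
    (hpsd : ∀ x : (Unit ⊕ (Fin T ⊕ Fin T × Fin Nu)) → ℝ,
      0 ≤ x ⬝ᵥ
        ((Matrix.diagonal
            (Sum.elim (fun _ : Unit => lam 0)
              (Sum.elim (fun _ : Fin T => lam 1)
                (fun p : Fin T × Fin Nu => lam p.1.succ.succ))) -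
          Matrix.fromBlocks (0 : Matrix Unit Unit ℝ)
            (Matrix.of fun (_ : Unit) j =>
              Sum.elim a (fun p : Fin T × Fin Nu => b p.1 p.2) j / 2)
            (Matrix.of fun i (_ : Unit) =>
              Sum.elim a (fun p : Fin T × Fin Nu => b p.1 p.2) i / 2)
            (0 : Matrix (Fin T ⊕ Fin T × Fin Nu) (Fin T ⊕ Fin T × Fin Nu) ℝ)).mulVec x))
    (hsum : (∑ k, lam k) + s ≤ 0) :
    euclNorm a + (∑ t, euclNorm (b t)) + s ≤ 0 := by
  obtain ⟨y, hy, hay⟩ := exists_sum_sq_le_one_sum_mul_eq_euclNorm a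
  choose z hz hbz using fun t => exists_sum_sq_le_one_sum_mul_eq_euclNorm (b t)
  have hx := hpsd (Sum.elim (fun _ => 1) (Sum.elim y fun p => z p.1 p.2))
  have hform : 0 ≤ lam 0 + lam 1 * ∑ i, y i ^ 2 + ∑ t, lam t.succ.succ * ∑ j, z t j ^ 2
      - ∑ i, a i * y i - ∑ t, ∑ j, b t j * z t j := by
    refine hx.trans_eq ?_
    have hy_entry : ∀ i, y i * (lam 1 * y i - a i / 2) =
        lam 1 * y i ^ 2 - a i * y i / 2 := fun i => by ring
    have hz_entry : ∀ t j, z t j * (lam t.succ.succ * z t j - b t j / 2) =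
        lam t.succ.succ * z t j ^ 2 - b t j * z t j / 2 := fun t j => by ring
    rw [Matrix.sub_mulVec, Matrix.fromBlocks_mulVec]
    simp [dotProduct, Matrix.mulVec, Fintype.sum_prod_type,
      Matrix.diagonal_apply, div_mul_eq_mul_div, hy_entry, hz_entry,
      Finset.sum_sub_distrib, ← Finset.mul_sum, ← Finset.sum_div]
    ring
  have hy_le : lam 1 * ∑ i, y i ^ 2 ≤ lam 1 := mul_le_of_le_one_right (hlam 1) hy
  have hz_le : ∑ t : Fin T, lam t.succ.succ * ∑ j, z t j ^ 2 ≤ ∑ t : Fin T, lam t.succ.succ :=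
    Finset.sum_le_sum fun t _ => mul_le_of_le_one_right (hlam _) (hz t)
  rw [Fin.sum_univ_succ, Fin.sum_univ_succ, Fin.succ_zero_eq_one] at hsum
  simp only [hay, hbz] at hform
  linarith
end
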